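/- Let k ≥ 1 with k ≡ 2 (mod 4) and h ∈ ℤ with gcd(h,k) = 1. Then ∑_{n=0}^{(k−2)/4} ζ_k^{hn} (−ζ_k^h;ζ_k^{2h})_n / (ζ_k^h;ζ_k^{2h})_{n+1} = i ∑_{n=0}^{k/2 − 1} (−1)^{n(n+1)/2} ζ_k^{hn(n+1)} (ζ_k^{2h};−ζ_k^{2h})_n / (iζ_k^h;−ζ_k^{2h})_{n+1}², all denominators on both sides being nonzero. -/

import Mathlib

open scoped BigOperators Classical
open Filter Topology

noncomputable section

/-- finite q-Pochhammer symbol $(x;q)_n$ -/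
def qPoch (x q : ℂ) (n : ℕ) : ℂ := ∏ j ∈ Finset.range n, (1 - x * q ^ j)

/-- infinite q-Pochhammer symbol $(x;q)_\infty$ -/
def qPochInf (x q : ℂ) : ℂ := ∏' j : ℕ, (1 - x * q ^ j)

/-- $e(x) = e^{2\pi i x}$ -/
def ee (x : ℂ) : ℂ := Complex.exp (2 * Real.pi * Complex.I * x)

/-- $\zeta_n^m = e(m/n)$ -/
def zeta (m : ℤ) (n : ℕ) : ℂ := ee ((m : ℂ) / (n : ℂ))

/-- Dedekind eta -/
def eta (τ : ℂ) : ℂ := Complex.exp (Real.pi * Complex.I * τ / 12) * qPochInf (ee τ) (ee τ)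

/-- Jacobi theta -/
def theta (z τ : ℂ) : ℂ :=
  -Complex.I * Complex.exp (Real.pi * Complex.I * τ / 4) * Complex.exp (-(Real.pi * Complex.I * z))
    * qPochInf (ee τ) (ee τ) * qPochInf (ee z) (ee τ) * qPochInf ((ee z)⁻¹ * ee τ) (ee τ)

/-- universal mock theta function g₂ -/
def g2 (ζ q : ℂ) : ℂ :=
  ∑' n : ℕ, qPoch (-q) q n * q ^ (n * (n + 1) / 2) /
    (qPoch ζ q (n + 1) * qPoch (ζ⁻¹ * q) q (n + 1))

/-- universal mock theta function g₃ -/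
def g3 (ζ q : ℂ) : ℂ :=
  ∑' n : ℕ, q ^ (n * (n + 1)) / (qPoch ζ q (n + 1) * qPoch (ζ⁻¹ * q) q (n + 1))

/-- the series L -/
def Lser (ζ q : ℂ) : ℂ :=
  (1 / 2) * ∑' n : ℕ, q ^ n * qPoch (ζ⁻¹ * q) q n * qPoch ζ q n / qPoch (-q) q n

/-- the function M -/
def Mfun (z τ : ℂ) : ℂ :=
  -(Complex.I / 2) * Complex.exp (Real.pi * Complex.I * z) * theta z τ *
    g3 (-(ee z)) (ee τ) / (Complex.exp (Real.pi * Complex.I * τ / 12) * eta (2 * τ))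

/-- the function T -/
def Tfun (z τ : ℂ) : ℂ :=
  -Complex.I * eta (2 * τ) ^ 4 / (ee z * eta τ ^ 2 * theta (2 * z) (2 * τ))
  - Complex.I * eta (2 * τ) ^ 10 * theta (2 * z + 1 / 2) (2 * τ) /
      (2 * ee z ^ 2 * Complex.exp (Real.pi * Complex.I * τ / 2) * eta τ ^ 4 * eta (4 * τ) ^ 4 *
        theta (2 * z) (2 * τ) * theta (2 * z + τ + 1 / 2) (2 * τ))
  - Complex.I * eta (2 * τ) ^ 4 * theta z τ /
      (2 * Complex.exp (Real.pi * Complex.I * τ / 2) * ee z ^ 2 * eta (4 * τ) ^ 2 *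
        theta (z + 1 / 2) τ * theta (2 * z + τ + 1 / 2) (2 * τ))

/-- the function K -/
def Kfun (z τ : ℂ) : ℂ :=
  eta (2 * τ) ^ 4 / (Complex.I * ee z * eta τ ^ 2 * theta (2 * z) (2 * τ))

/-- Zwegers' μ-function -/
def mu (z₁ z₂ τ : ℂ) : ℂ :=
  Complex.exp (Real.pi * Complex.I * z₁) / theta z₂ τ *
    ∑' n : ℤ, (-(ee z₂)) ^ n * Complex.exp (Real.pi * Complex.I * (n : ℂ) * ((n : ℂ) + 1) * τ) /
      (1 - ee z₁ * (ee τ) ^ n)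

/-- the Appell–Lerch sum A -/
def appell (ζ q : ℂ) : ℂ :=
  ∑' n : ℤ, (-1 : ℂ) ^ n * q ^ ((3 * n * (n + 1)) / 2) / (1 + ζ * q ^ n)

/-- the function Θ -/
def bigTheta (z₁ z₂ z τ : ℂ) : ℂ :=
  (1 / (2 * Real.pi * Complex.I)) * deriv (fun w => theta w τ) 0 *
    theta (z₁ + z₂ + z) τ * theta z τ /
    (theta z₁ τ * theta z₂ τ * theta (z₁ + z) τ * theta (z₂ + z) τ)

/-- the function 𝔱 -/
def tfrak (z τ : ℂ) : ℂ :=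
  Kfun z τ - Complex.I * Kfun (z + 1 / 4) (τ + 1 / 2) +
    Complex.I * Complex.exp (-(Real.pi * Complex.I * τ / 2)) * bigTheta (2 * z) τ (1 / 2) (2 * τ)

/-- the second order mock theta function B -/
def mockB (q : ℂ) : ℂ :=
  ∑' n : ℕ, q ^ n * qPoch (-q) (q ^ 2) n / qPoch q (q ^ 2) (n + 1)

/-- Ramanujan's third order mock theta function f -/
def mockf (q : ℂ) : ℂ := ∑' n : ℕ, q ^ (n ^ 2) / qPoch (-q) q n ^ 2

/-- the modular form b -/
def bfun (q : ℂ) : ℂ := qPochInf q q / qPochInf (-q) q ^ 2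

/-- τ(t) = h/k + it/(2π) -/
def tauT (h k : ℕ) (t : ℝ) : ℂ := (h : ℂ) / (k : ℂ) + Complex.I * (t : ℂ) / (2 * Real.pi)

/-- q(t) = e^{2πiτ(t)} -/
def qT (h k : ℕ) (t : ℝ) : ℂ := ee (tauT h k t)

lemma qPoch_succ (x q : ℂ) (n : ℕ) : qPoch x q (n + 1) = qPoch x q n * (1 - x * q ^ n) :=
  Finset.prod_range_succ _ _

lemma qPoch_succ' (x q : ℂ) (n : ℕ) : qPoch x q (n + 1) = (1 - x) * qPoch (x * q) q n := by
  simp only [qPoch, Finset.prod_range_succ', pow_zero, mul_one]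
  rw [mul_comm]
  congr 1
  exact Finset.prod_congr rfl fun j _ => by ring

lemma qPoch_eq_zero {x q : ℂ} {n j : ℕ} (hj : j < n) (h : x * q ^ j = 1) : qPoch x q n = 0 :=
  Finset.prod_eq_zero (Finset.mem_range.2 hj) (by rw [h, sub_self])

lemma qPoch_ne_zero {x q : ℂ} (h : ∀ j, x * q ^ j ≠ 1) (n : ℕ) : qPoch x q n ≠ 0 :=
  Finset.prod_ne_zero_iff.2 fun j _ => sub_ne_zero.2 (h j).symm

lemma div_qPoch_mul_self {x q : ℂ} (hx : x ≠ 1) (a : ℂ) (n : ℕ) :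
    a / qPoch (x * q) q n = a * (1 - x) / qPoch x q (n + 1) := by
  rw [qPoch_succ', mul_comm a, mul_div_mul_left _ _ (sub_ne_zero.2 hx.symm)]

/-- Partial sums of the universal mock theta function `g2`. -/
def g2Sum (q : ℂ) (M : ℕ) (x : ℂ) : ℂ :=
  ∑ n ∈ Finset.range M, qPoch (-q) q n * q ^ (n * (n + 1) / 2) /
    (qPoch x q (n + 1) * qPoch (x⁻¹ * q) q (n + 1))

/-- Partial sums of a second series for the universal mock theta function `g2`. -/
def g2SumAlt (q : ℂ) (M : ℕ) (x : ℂ) : ℂ :=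
  ∑ n ∈ Finset.range M, qPoch (-x) q n * (x⁻¹ * q) ^ n / qPoch x q (n + 1)

lemma g2Sum_mul {q x : ℂ} (hq : q ≠ 0) (hx : x ≠ 0) (h : ∀ j, x * q ^ j ≠ 1)
    (h' : ∀ j, x⁻¹ * q ^ j ≠ 1) (M : ℕ) :
    g2Sum q M (x * q) + x ^ 2 * g2Sum q M x = -x - (1 - x) ^ 2 *
      (qPoch (-q) q M * q ^ (M * (M + 1) / 2) / (qPoch x q (M + 1) * qPoch x⁻¹ q (M + 1))) := by
  have hx1 : x ≠ 1 := by simpa using h 0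
  have hx1' : x⁻¹ ≠ 1 := by simpa using h' 0
  have e1 : 1 - x ≠ 0 := sub_ne_zero.2 hx1.symm
  induction M with
  | zero =>
    have e2 : x - 1 ≠ 0 := sub_ne_zero.2 hx1
    simp [g2Sum, qPoch]
    field_simp
    ring
  | succ M ih =>
    have inv : (x * q)⁻¹ * q = x⁻¹ := by field_simp
    have tri : (M + 1) * (M + 1 + 1) / 2 = M * (M + 1) / 2 + (M + 1) := by
      rw [show (M + 1) * (M + 1 + 1) = M * (M + 1) + (M + 1) * 2 by ring,
        Nat.add_mul_div_right _ _ two_pos]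
    have step : ∀ a b c d : ℂ, a + b + x ^ 2 * (c + d) = (a + x ^ 2 * c) + (b + x ^ 2 * d) := by
      intros; ring
    have d1 : qPoch x q (M + 1) ≠ 0 := qPoch_ne_zero h _
    have d2 : qPoch x⁻¹ q (M + 1) ≠ 0 := qPoch_ne_zero h' _
    have d3 : 1 - x * q ^ (M + 1) ≠ 0 := sub_ne_zero.2 (h _).symm
    have d4 : 1 - x⁻¹ * q ^ (M + 1) ≠ 0 := sub_ne_zero.2 (h' _).symm
    rw [g2Sum, g2Sum, Finset.sum_range_succ, Finset.sum_range_succ, step, ← g2Sum, ← g2Sum, ih,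
      inv, ← div_div _ (qPoch (x * q) q _), div_qPoch_mul_self hx1,
      ← div_div _ (qPoch x q _) (qPoch (x⁻¹ * q) q _), div_qPoch_mul_self hx1', tri, pow_add,
      qPoch_succ x q (M + 1), qPoch_succ x⁻¹ q (M + 1), qPoch_succ (-q) q M]
    have d4' : x - q ^ (M + 1) ≠ 0 := by
      intro h0
      apply d4
      rw [← sub_eq_zero.1 h0, inv_mul_cancel₀ hx, sub_self]
    have d4e : 1 - x⁻¹ * q ^ (M + 1) = (x - q ^ (M + 1)) / x := by field_simp
    rw [d4e]
    rw [show -q * q ^ M = -q ^ (M + 1) by ring]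
    generalize qPoch x q (M + 1) = A at *
    generalize qPoch x⁻¹ q (M + 1) = B at *
    generalize qPoch (-q) q M = C at *
    generalize q ^ (M * (M + 1) / 2) = D at *
    generalize q ^ (M + 1) = y at *
    field_simp
    ring

lemma g2SumAlt_mul {q x : ℂ} (hq : q ≠ 0) (hx : x ≠ 0) (h : ∀ j, x * q ^ j ≠ 1) (M : ℕ) :
    g2SumAlt q (M + 1) (x * q) + x ^ 2 * g2SumAlt q (M + 1) x =
      -x - qPoch (-x * q) q M * x⁻¹ ^ (M + 1) * (x ^ 3 * q ^ (M + 1) - x) /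
        qPoch x q (M + 2) := by
  have hx1 : x ≠ 1 := by simpa using h 0
  have e1 : 1 - x ≠ 0 := sub_ne_zero.2 hx1.symm
  have inv : (x * q)⁻¹ * q = x⁻¹ := by field_simp
  induction M with
  | zero =>
    have e2 : 1 - x * q ≠ 0 := sub_ne_zero.2 (by simpa using (h 1).symm)
    simp [g2SumAlt, qPoch, Finset.prod_range_succ]
    field_simp
    ring
  | succ M ih =>
    have step : ∀ a b c d : ℂ, a + b + x ^ 2 * (c + d) = (a + x ^ 2 * c) + (b + x ^ 2 * d) := by
      intros; ring
    have d1 : qPoch x q (M + 2) ≠ 0 := qPoch_ne_zero h _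
    have d3 : 1 - x * q ^ (M + 2) ≠ 0 := sub_ne_zero.2 (h _).symm
    rw [g2SumAlt, g2SumAlt, Finset.sum_range_succ, Finset.sum_range_succ _ (M + 1), step,
      ← g2SumAlt, ← g2SumAlt, ih, inv, div_qPoch_mul_self hx1, qPoch_succ x q (M + 1 + 1),
      qPoch_succ' (-x), ← neg_mul, qPoch_succ (-x * q) q M, mul_pow]
    rw [show M + 1 + 1 = M + 2 from rfl, show -x * q * q ^ M = - x * q ^ (M + 1) by ring]
    rw [pow_succ x⁻¹ (M + 1)]
    rw [show x * q ^ (M + 2) = x * q ^ (M + 1) * q by ring] at d3 ⊢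
    rw [show q ^ (M + 2) = q ^ (M + 1) * q by ring]
    generalize qPoch x q (M + 2) = A at *
    generalize qPoch (-x * q) q M = C at *
    generalize x⁻¹ ^ (M + 1) = D at *
    generalize q ^ (M + 1) = y at *
    field_simp
    ring

/-- Iterating the functional equation `f (x * q) = -x - x ^ 2 * f x` produces a partial theta
sum. -/
lemma eq_sum_of_mul_eq {f : ℂ → ℂ} {q x : ℂ} (hq : q ≠ 0) (hx : x ≠ 0) (M : ℕ)
    (h : ∀ j, f (x * q ^ j * q) + (x * q ^ j) ^ 2 * f (x * q ^ j) = -(x * q ^ j)) :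
    f x = ∑ l ∈ Finset.range M, (-1) ^ (l + 1) * x⁻¹ ^ (2 * l + 1) * q⁻¹ ^ (l ^ 2) +
      (-1) ^ M * x⁻¹ ^ (2 * M) * q⁻¹ ^ (M * (M - 1)) * f (x * q ^ M) := by
  induction M with
  | zero => simp
  | succ M ih =>
    have hM : x * q ^ M ≠ 0 := by positivity
    have key : f (x * q ^ M) =
        -(x * q ^ M)⁻¹ - (x * q ^ M)⁻¹ ^ 2 * f (x * q ^ (M + 1)) := by
      have := h M
      rw [mul_assoc x, ← pow_succ] at this
      field_simp
      linear_combination this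
    have e : M * (M - 1) + M = M ^ 2 := by
      cases M with
      | zero => rfl
      | succ n => simp only [Nat.add_sub_cancel]; ring
    have e' : (M + 1) * (M + 1 - 1) = M * (M - 1) + M + M := by
      rw [e, Nat.add_sub_cancel]; ring
    rw [Finset.sum_range_succ, e', ← e, ih, key, mul_inv, ← inv_pow]
    ring

lemma two_mul_g2SumAlt {q : ℂ} {m : ℕ} (hm : Odd m) (hq : q ^ m = -1) :
    2 * g2SumAlt (q ^ 2) m q =
      ∑ l ∈ Finset.range m, (-1) ^ (l + 1) * q⁻¹ ^ (2 * l + 1) * (q ^ 2)⁻¹ ^ (l ^ 2) := by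
  have q0 : q ≠ 0 := by
    rintro rfl
    simp [hm.pos.ne'] at hq
  have hq2 : (q ^ 2) ^ m = 1 := by rw [← pow_mul, mul_comm, pow_mul, hq]; norm_num
  have hodd : ∀ n, Odd n → q ^ n ≠ 1 := fun n hn h1 => by
    have : (q ^ n) ^ m = -1 := by rw [← pow_mul, mul_comm, pow_mul, hq, hn.neg_one_pow]
    rw [h1, one_pow] at this
    norm_num at this
  obtain ⟨r, rfl⟩ := hm
  have key := eq_sum_of_mul_eq (f := g2SumAlt (q ^ 2) (2 * r + 1)) (pow_ne_zero 2 q0) q0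
    (2 * r + 1) fun j => by
      have hx : q * (q ^ 2) ^ j = q ^ (2 * j + 1) := by ring
      rw [hx, g2SumAlt_mul (pow_ne_zero 2 q0) (pow_ne_zero _ q0) fun i => by
        rw [← pow_mul, ← pow_add]
        exact hodd _ ⟨j + i, by ring⟩]
      have hz : qPoch (-q ^ (2 * j + 1)) (q ^ 2) (2 * r + 1) = 0 := by
        refine qPoch_eq_zero (Nat.mod_lt (r + 2 * r * j) (Nat.succ_pos _)) ?_
        rw [← pow_eq_pow_mod _ hq2, neg_mul, ← pow_mul, ← pow_add,
          show 2 * j + 1 + 2 * (r + 2 * r * j) = (2 * r + 1) * (2 * j + 1) by ring, pow_mul, hq,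
          (show Odd (2 * j + 1) from ⟨j, rfl⟩).neg_one_pow, neg_neg]
      rw [qPoch_succ'] at hz
      rw [hq2]
      rw [show qPoch (-q ^ (2 * j + 1) * q ^ 2) (q ^ 2) (2 * r) * (q ^ (2 * j + 1))⁻¹ ^ (2 * r + 1) *
        ((q ^ (2 * j + 1)) ^ 3 * 1 - q ^ (2 * j + 1)) = 0 by
          linear_combination (-q ^ (2 * j + 1) * (1 - q ^ (2 * j + 1)) *
            (q ^ (2 * j + 1))⁻¹ ^ (2 * r + 1)) * hz]
      simp
  have h1 : q⁻¹ ^ (2 * (2 * r + 1)) = 1 := by rw [inv_pow, pow_mul, hq2, inv_one]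
  have h2 : (q ^ 2)⁻¹ ^ ((2 * r + 1) * (2 * r + 1 - 1)) = 1 := by
    rw [inv_pow, pow_mul, hq2, one_pow, inv_one]
  rw [hq2, h1, h2, (show Odd (2 * r + 1) from ⟨r, rfl⟩).neg_one_pow] at key
  simp only [mul_one] at key
  linear_combination key

lemma one_sub_mul_g2Sum {q x : ℂ} {m : ℕ} (hm : Odd m) (hq : q ^ m = -1) (hx0 : x ≠ 0)
    (hx : x ^ (4 * m) ≠ 1) :
    (1 - x⁻¹ ^ (2 * m)) * g2Sum q m x =
      ∑ l ∈ Finset.range m, (-1) ^ (l + 1) * x⁻¹ ^ (2 * l + 1) * q⁻¹ ^ (l ^ 2) := by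
  have q0 : q ≠ 0 := by
    rintro rfl
    simp [hm.pos.ne'] at hq
  have hq4 : ∀ j, (q ^ j) ^ (4 * m) = 1 := fun j => by
    rw [← pow_mul, show j * (4 * m) = m * (2 * (2 * j)) by ring, pow_mul, hq, pow_mul]
    norm_num
  have hq2 : q ^ (2 * m) = 1 := by rw [mul_comm, pow_mul, hq]; norm_num
  have hz : qPoch (-q) q m = 0 := by
    obtain ⟨r, rfl⟩ := hm
    refine qPoch_eq_zero (Nat.lt_succ_self (2 * r)) ?_
    rw [neg_mul, ← pow_succ', hq, neg_neg]
  have key := eq_sum_of_mul_eq (f := g2Sum q m) q0 hx0 (2 * m) fun j => by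
    have hy : (x * q ^ j) ^ (4 * m) ≠ 1 := by rwa [mul_pow, hq4, mul_one]
    rw [g2Sum_mul q0 (mul_ne_zero hx0 (pow_ne_zero _ q0)) (fun i h1 => ?_) (fun i h1 => ?_), hz]
    · simp
    · apply hy
      simpa only [mul_pow _ (q ^ i), hq4, mul_one, one_pow] using congrArg (· ^ (4 * m)) h1
    · apply hy
      simpa only [mul_pow _ (q ^ i), hq4, mul_one, one_pow, inv_pow, inv_eq_one] using
        congrArg (· ^ (4 * m)) h1
  have shift : ∀ l, (-1 : ℂ) ^ (m + l + 1) * x⁻¹ ^ (2 * (m + l) + 1) * q⁻¹ ^ ((m + l) ^ 2) =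
      x⁻¹ ^ (2 * m) * ((-1) ^ (l + 1) * x⁻¹ ^ (2 * l + 1) * q⁻¹ ^ (l ^ 2)) := fun l => by
    have e : q⁻¹ ^ ((m + l) ^ 2) = -q⁻¹ ^ (l ^ 2) := by
      rw [show (m + l) ^ 2 = m * (m + 2 * l) + l ^ 2 by ring, pow_add, pow_mul, inv_pow q m, hq,
        inv_neg, inv_one, (hm.add_even (even_two_mul l)).neg_one_pow, neg_one_mul]
    rw [e, add_assoc m, pow_add, hm.neg_one_pow, show 2 * (m + l) + 1 = 2 * m + (2 * l + 1) by ring,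
      pow_add]
    ring
  have h2 : q⁻¹ ^ (2 * m * (2 * m - 1)) = 1 := by rw [inv_pow, pow_mul, hq2, one_pow, inv_one]
  have hu : x⁻¹ ^ (2 * (2 * m)) = (x⁻¹ ^ (2 * m)) ^ 2 := by ring
  rw [hq2, h2, mul_one, mul_one, (even_two_mul m).neg_one_pow, one_mul, two_mul m,
    Finset.sum_range_add, ← two_mul, Finset.sum_congr rfl fun l _ => shift l, ← Finset.mul_sum,
    hu] at key
  have hne : 1 + x⁻¹ ^ (2 * m) ≠ 0 := fun h0 => hx <| by
    rw [← inv_inj, ← inv_pow, inv_one, show 4 * m = 2 * (2 * m) by ring, hu,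
      eq_neg_of_add_eq_zero_right h0]
    norm_num
  apply mul_left_cancel₀ hne
  linear_combination key

lemma continuous_qPoch (q : ℂ) (n : ℕ) : Continuous fun x => qPoch x q n := by
  unfold qPoch
  fun_prop

lemma two_mul_g2Sum {q t : ℂ} {m : ℕ} (hm : Odd m) (hq : q ^ m = -1) (ht : t ^ (2 * m) = -1) :
    2 * g2Sum q m t =
      ∑ l ∈ Finset.range m, (-1) ^ (l + 1) * t⁻¹ ^ (2 * l + 1) * q⁻¹ ^ (l ^ 2) := by
  have t0 : t ≠ 0 := by
    rintro rfl
    simp [hm.pos.ne'] at ht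
  have hq2 : ∀ j, (q ^ j) ^ (2 * m) = 1 := fun j => by
    rw [← pow_mul, show j * (2 * m) = m * (2 * j) by ring, pow_mul, hq, pow_mul]
    norm_num
  have hne : ∀ j, t * q ^ j ≠ 1 := fun j h1 => by
    have := congrArg (· ^ (2 * m)) h1
    simp only [mul_pow, hq2, ht, one_pow] at this
    norm_num at this
  have hne' : ∀ j, t⁻¹ * q * q ^ j ≠ 1 := fun j h1 => by
    have := congrArg (· ^ (2 * m)) h1
    simp only [mul_assoc, ← pow_succ', mul_pow t⁻¹, hq2, inv_pow, ht, one_pow] at this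
    norm_num at this
  have hcont : ContinuousAt (g2Sum q m) t := by
    unfold g2Sum
    refine tendsto_finsetSum _ fun n _ => ContinuousAt.div continuousAt_const ?_
      (mul_ne_zero (qPoch_ne_zero hne _) (qPoch_ne_zero hne' _))
    have hi : ContinuousAt (fun x : ℂ => x⁻¹ * q) t := by fun_prop (disch := assumption)
    exact (continuous_qPoch q _).continuousAt.mul
      (ContinuousAt.comp (f := fun x : ℂ => x⁻¹ * q) (continuous_qPoch q _).continuousAt hi)
  let u : ℕ → ℂ := fun n => t * (1 + 1 / ((n : ℂ) + 1))
  have hu : Tendsto u atTop (𝓝 t) := by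
    simpa [u] using (tendsto_one_div_add_atTop_nhds_zero_nat (𝕜 := ℂ)).const_add 1 |>.const_mul t
  have hre : ∀ n : ℕ, 1 + 1 / ((n : ℂ) + 1) = ((1 + 1 / ((n : ℝ) + 1) : ℝ) : ℂ) := fun n => by
    push_cast
    rfl
  have h4 : t ^ (4 * m) = 1 := by
    rw [show 4 * m = 2 * m * 2 by ring, pow_mul, ht]; norm_num
  have hu4 : ∀ n, u n ^ (4 * m) ≠ 1 := fun n => by
    have hgt : (1 : ℝ) < (1 + 1 / ((n : ℝ) + 1)) ^ (4 * m) :=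
      one_lt_pow₀ (lt_add_of_pos_right _ (by positivity)) (by have := hm.pos; lia)
    simp only [u, mul_pow, h4, one_mul, hre]
    rw [← Complex.ofReal_pow]
    exact Complex.ofReal_ne_one.2 hgt.ne'
  have hu0 : ∀ n, u n ≠ 0 := fun n h0 => by
    have hpos : (1 + 1 / ((n : ℝ) + 1)) ≠ 0 := by positivity
    rcases mul_eq_zero.1 h0 with h | h
    · exact t0 h
    · exact hpos (Complex.ofReal_eq_zero.1 (hre n ▸ h))
  have hL : ContinuousAt (fun x => (1 - x⁻¹ ^ (2 * m)) * g2Sum q m x) t :=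
    ContinuousAt.mul (by fun_prop (disch := assumption)) hcont
  have hR : ContinuousAt (fun x => ∑ l ∈ Finset.range m,
      (-1) ^ (l + 1) * x⁻¹ ^ (2 * l + 1) * q⁻¹ ^ (l ^ 2)) t := by
    fun_prop (disch := assumption)
  have := tendsto_nhds_unique (hL.tendsto.comp hu) ((hR.tendsto.comp hu).congr fun n =>
    (one_sub_mul_g2Sum hm hq (hu0 n) (hu4 n)).symm)
  rw [← this, inv_pow, ht]
  norm_num

lemma zeta_pow_half {m : ℕ} (hm : Odd m) {h : ℤ} (hh : Odd h) : zeta h (2 * m) ^ m = -1 := by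
  have m0 : (m : ℂ) ≠ 0 := by exact_mod_cast hm.pos.ne'
  obtain ⟨r, rfl⟩ := hh
  rw [zeta, ee, ← Complex.exp_nat_mul,
    show (m : ℂ) * (2 * Real.pi * Complex.I * (((2 * r + 1 : ℤ) : ℂ) / ((2 * m : ℕ) : ℂ))) =
      Real.pi * Complex.I + r * (2 * Real.pi * Complex.I) by push_cast; field_simp; ring,
    Complex.exp_add, Complex.exp_pi_mul_I, Complex.exp_int_mul_two_pi_mul_I, mul_one]

lemma zeta_two_mul (h : ℤ) (k : ℕ) : zeta (2 * h) k = zeta h k ^ 2 := by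
  rw [zeta, zeta, ee, ee, ← Complex.exp_nat_mul]
  congr 1
  push_cast
  ring

lemma sum_eq_I_mul_sum {q : ℂ} {r : ℕ} (hq : q ^ (2 * r + 1) = -1) :
    (∀ n, qPoch q (q ^ 2) n ≠ 0) ∧ (∀ n, qPoch (Complex.I * q) (-q ^ 2) n ≠ 0) ∧
    ∑ n ∈ Finset.range (r + 1), q ^ n * qPoch (-q) (q ^ 2) n / qPoch q (q ^ 2) (n + 1) =
      Complex.I * ∑ n ∈ Finset.range (2 * r + 1),
        (-1 : ℂ) ^ (n * (n + 1) / 2) * q ^ (n * (n + 1)) * qPoch (q ^ 2) (-q ^ 2) n /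
          qPoch (Complex.I * q) (-q ^ 2) (n + 1) ^ 2 := by
  have hm : Odd (2 * r + 1) := ⟨r, rfl⟩
  have q0 : q ≠ 0 := by
    rintro rfl
    simp at hq
  have hP : (-q ^ 2) ^ (2 * r + 1) = -1 := by
    rw [hm.neg_pow, ← pow_mul, mul_comm, pow_mul, hq]; norm_num
  have hT : (Complex.I * q) ^ (2 * (2 * r + 1)) = -1 := by
    rw [pow_mul, mul_pow, Complex.I_sq, neg_one_mul, hP]
  refine ⟨fun n => qPoch_ne_zero (fun j h1 => ?_) n, fun n => qPoch_ne_zero (fun j h1 => ?_) n, ?_⟩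
  · have := congrArg (· ^ (2 * r + 1)) h1
    simp only [← pow_mul, ← pow_succ'] at this
    rw [mul_comm, pow_mul, hq, (show Odd (2 * j + 1) from ⟨j, rfl⟩).neg_one_pow, one_pow] at this
    norm_num at this
  · have := congrArg (· ^ (2 * (2 * r + 1))) h1
    simp only [mul_pow _ ((-q ^ 2) ^ j), hT, one_pow] at this
    rw [← pow_mul, show j * (2 * (2 * r + 1)) = (2 * r + 1) * (2 * j) by ring, pow_mul, hP,
      (even_two_mul j).neg_one_pow] at this
    norm_num at this
  · have hL : ∑ n ∈ Finset.range (r + 1), q ^ n * qPoch (-q) (q ^ 2) n / qPoch q (q ^ 2) (n + 1) =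
        g2SumAlt (q ^ 2) (2 * r + 1) q := by
      rw [g2SumAlt, ← Finset.sum_subset (Finset.range_mono (show r + 1 ≤ 2 * r + 1 by lia))]
      · refine Finset.sum_congr rfl fun n _ => ?_
        rw [show q⁻¹ * q ^ 2 = q by field_simp, mul_comm (q ^ n)]
      · intro n _ hn
        rw [qPoch_eq_zero (j := r) (by simpa using hn), zero_mul, zero_div]
        rw [neg_mul, ← pow_mul, ← pow_succ', hq, neg_neg]
    have hR : ∑ n ∈ Finset.range (2 * r + 1),
        (-1 : ℂ) ^ (n * (n + 1) / 2) * q ^ (n * (n + 1)) * qPoch (q ^ 2) (-q ^ 2) n /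
          qPoch (Complex.I * q) (-q ^ 2) (n + 1) ^ 2 =
        g2Sum (-q ^ 2) (2 * r + 1) (Complex.I * q) := by
      refine Finset.sum_congr rfl fun n _ => ?_
      have hi : (Complex.I * q)⁻¹ * -q ^ 2 = Complex.I * q := by
        rw [mul_inv, Complex.inv_I]; field_simp
      have hp : (-q ^ 2) ^ (n * (n + 1) / 2) = (-1) ^ (n * (n + 1) / 2) * q ^ (n * (n + 1)) := by
        rw [neg_pow, ← pow_mul, Nat.mul_div_cancel' (Nat.even_mul_succ_self n).two_dvd]
      rw [hi, hp, neg_neg, ← sq, mul_comm (qPoch _ _ n)]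
    rw [hL, hR]
    apply mul_left_cancel₀ (two_ne_zero (α := ℂ))
    rw [mul_left_comm, two_mul_g2SumAlt hm hq, two_mul_g2Sum hm hP hT, Finset.mul_sum]
    refine Finset.sum_congr rfl fun l _ => ?_
    have hI : Complex.I * (-Complex.I) ^ (2 * l + 1) * (-1) ^ (l ^ 2) = 1 := by
      have hl : (-1 : ℂ) ^ l * (-1) ^ (l ^ 2) = 1 := by
        rw [← pow_add, show l + l ^ 2 = l * (l + 1) by ring,
          (Nat.even_mul_succ_self l).neg_one_pow]
      rw [pow_succ, pow_mul, neg_sq, Complex.I_sq]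
      linear_combination hl - (-1 : ℂ) ^ l * (-1) ^ (l ^ 2) * Complex.I_sq
    rw [mul_inv, Complex.inv_I, inv_neg, neg_pow (q ^ 2)⁻¹, mul_pow]
    linear_combination (-((-1 : ℂ) ^ (l + 1) * q⁻¹ ^ (2 * l + 1) * (q ^ 2)⁻¹ ^ (l ^ 2))) * hI

/-- The curious identity (6.3) for k ≡ 2 (mod 4). -/
theorem statement18 (k : ℕ) (hk : 1 ≤ k) (h2 : k % 4 = 2) (h : ℤ) (hghk : Int.gcd h k = 1) :
    (∀ n : ℕ, n ≤ (k - 2) / 4 →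
      qPoch (zeta h k) (zeta (2 * h) k) (n + 1) ≠ 0) ∧
    (∀ n : ℕ, n < k / 2 →
      qPoch (Complex.I * zeta h k) (-(zeta (2 * h) k)) (n + 1) ≠ 0) ∧
    ∑ n ∈ Finset.range ((k - 2) / 4 + 1),
        (zeta h k) ^ n * qPoch (-(zeta h k)) (zeta (2 * h) k) n /
          qPoch (zeta h k) (zeta (2 * h) k) (n + 1) =
      Complex.I * ∑ n ∈ Finset.range (k / 2),
        (-1 : ℂ) ^ (n * (n + 1) / 2) * (zeta h k) ^ (n * (n + 1)) *
          qPoch (zeta (2 * h) k) (-(zeta (2 * h) k)) n /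
          qPoch (Complex.I * zeta h k) (-(zeta (2 * h) k)) (n + 1) ^ 2 := by
  obtain ⟨r, rfl⟩ : ∃ r, k = 2 * (2 * r + 1) := ⟨k / 4, by lia⟩
  have hh : Odd h := by
    rw [← Int.not_even_iff_odd]
    intro he
    have h2' := Int.dvd_coe_gcd he.two_dvd
      (show (2 : ℤ) ∣ ((2 * (2 * r + 1) : ℕ) : ℤ) from ⟨2 * r + 1, by push_cast; ring⟩)
    rw [hghk] at h2'
    norm_num at h2'
  obtain ⟨hA, hB, hC⟩ := sum_eq_I_mul_sum (zeta_pow_half ⟨r, rfl⟩ hh)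
  rw [zeta_two_mul, show (2 * (2 * r + 1) - 2) / 4 = r by lia,
    show 2 * (2 * r + 1) / 2 = 2 * r + 1 by lia]
  exact ⟨fun n _ => hA _, fun n _ => hB _, hC⟩

end
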